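/- arXiv:1912.01261 — 8 statements merged into one kernel-verified Lean document; each statement's English description precedes it below -/
import Mathlib

section
/- If the bifunction f is (α,β)-regular, then the diagonal map F(x) = ∇f_x(x) is (α−β)-strongly monotone on X: for all x, y ∈ X, ⟨∇f_x(x) − ∇f_y(y), x − y⟩ ≥ (α−β)·‖x−y‖². -/
open RealInnerProductSpace

/-- First-order lower bound for a strongly convex function at a point of differentiability. -/
theorem StrongConvexOn.add_inner_gradient_le
    {E : Type*} [NormedAddCommGroup E] [InnerProductSpace ℝ E] [CompleteSpace E]
    {s : Set E} {m : ℝ} {f : E → ℝ} (hf : StrongConvexOn s m f) {x y g : E}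
    (hx : x ∈ s) (hy : y ∈ s) (hg : HasGradientAt f g x) :
    f x + ⟪g, y - x⟫ + m / 2 * ‖x - y‖ ^ 2 ≤ f y := by
  have hslope := (hg.hasFDerivAt.hasLineDerivAt (y - x)).tendsto_slope_zero_right
  have hbound : Filter.Tendsto (fun t : ℝ => f y - f x - (1 - t) * (m / 2 * ‖x - y‖ ^ 2))
      (nhdsWithin 0 (Set.Ioi 0)) (nhds (f y - f x - (1 - 0) * (m / 2 * ‖x - y‖ ^ 2))) :=
    (Continuous.tendsto (by fun_prop) 0).mono_left nhdsWithin_le_nhds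
  have hle := le_of_tendsto_of_tendsto hslope hbound (by
    filter_upwards [Ioo_mem_nhdsGT (zero_lt_one' ℝ)] with t ht
    have h := hf.2 hx hy (sub_nonneg.2 ht.2.le) ht.1.le (sub_add_cancel 1 t)
    have hpoint : (1 - t) • x + t • y = x + t • (y - x) := by module
    rw [hpoint] at h
    simp only [smul_eq_mul] at h ⊢
    rw [inv_mul_le_iff₀ ht.1]
    linarith)
  rw [InnerProductSpace.toDual_apply_apply] at hle
  linarith

/-- The gradient of an `m`-strongly convex function is `m`-strongly monotone. -/
theorem StrongConvexOn.le_inner_gradient_sub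
    {E : Type*} [NormedAddCommGroup E] [InnerProductSpace ℝ E] [CompleteSpace E]
    {s : Set E} {m : ℝ} {f : E → ℝ} (hf : StrongConvexOn s m f) {x y g h : E}
    (hx : x ∈ s) (hy : y ∈ s) (hg : HasGradientAt f g x) (hh : HasGradientAt f h y) :
    m * ‖x - y‖ ^ 2 ≤ ⟪g - h, x - y⟫ := by
  have h₁ := hf.add_inner_gradient_le hx hy hg
  have h₂ := hf.add_inner_gradient_le hy hx hh
  rw [norm_sub_rev y x] at h₂
  rw [← neg_sub x y, inner_neg_right] at h₁
  rw [inner_sub_left]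
  linarith

/-- If the bifunction `f` is `(α,β)`-regular, then the diagonal map `F(x) = ∇f_x(x)` is
`(α−β)`-strongly monotone on `X`. -/
theorem stmt_0
    {E : Type*} [NormedAddCommGroup E] [InnerProductSpace ℝ E] [FiniteDimensional ℝ E]
    (X : Set E) (hXne : X.Nonempty) (hXcp : IsCompact X) (hXcv : Convex ℝ X)
    (f : E → E → ℝ) (f' : E → E → E) (α β : ℝ)
    -- `f' x x'` is the gradient of the loss `f x` at `x'`
    (hgrad : ∀ x ∈ X, ∀ x' ∈ X, HasGradientAt (f x) (f' x x') x')
    -- for every `x ∈ X`, the function `f_x` is `α`-strongly convex on `X`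
    (hsc : ∀ x ∈ X, StrongConvexOn X α (f x))
    -- for every `x' ∈ X`, the map `x ↦ ∇f_x(x')` is `β`-Lipschitz on `X`
    (hlip : ∀ x' ∈ X, ∀ x ∈ X, ∀ y ∈ X, ‖f' x x' - f' y x'‖ ≤ β * ‖x - y‖) :
    ∀ x ∈ X, ∀ y ∈ X, ⟪f' x x - f' y y, x - y⟫ ≥ (α - β) * ‖x - y‖ ^ 2 := by
  intro x hx y hy
  have hmono := (hsc x hx).le_inner_gradient_sub hx hy (hgrad x hx x hx) (hgrad x hx y hy)
  have hdiff : -(β * ‖x - y‖ * ‖x - y‖) ≤ ⟪f' x y - f' y y, x - y⟫ :=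
    (neg_le_neg (mul_le_mul_of_nonneg_right (hlip y hy x hx y hy) (norm_nonneg _))).trans
      (abs_le.1 (abs_real_inner_le_norm _ _)).1
  have hsplit : f' x x - f' y y = (f' x x - f' x y) + (f' x y - f' y y) := by abel
  rw [hsplit, inner_add_left]
  linarith
end

section
/- If F : E → E is continuous and X is a nonempty compact convex subset of a finite-dimensional real inner product space E, then the variational inequality VI(X,F) has at least one solution: there exists x* ∈ X such that ⟨F(x*), x − x*⟩ ≥ 0 for all x ∈ X. -/
open RealInnerProductSpace

open Set Filter Topology MeasureTheory

/-- The metric projection onto a nonempty complete convex set, characterised by its variational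
inequality. -/
theorem exists_convex_projection {E : Type*} [NormedAddCommGroup E] [InnerProductSpace ℝ E]
    {X : Set E} (hne : X.Nonempty) (hX : IsComplete X) (hcv : Convex ℝ X) :
    ∃ P : E → E, (∀ x, P x ∈ X) ∧ (∀ x, ∀ y ∈ X, ⟪x - P x, y - P x⟫ ≤ 0) ∧ LipschitzWith 1 P := by
  choose P hPX hP using exists_norm_eq_iInf_of_complete_convex hne hX hcv
  have hvi : ∀ x, ∀ y ∈ X, ⟪x - P x, y - P x⟫ ≤ 0 := fun x =>
    (norm_eq_iInf_iff_real_inner_le_zero hcv (hPX x)).1 (hP x)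
  refine ⟨P, hPX, hvi, LipschitzWith.of_dist_le_mul fun x y => ?_⟩
  rw [dist_eq_norm, dist_eq_norm, NNReal.coe_one, one_mul]
  have h₁ := hvi x (P y) (hPX y)
  have h₂ := hvi y (P x) (hPX x)
  have h₃ : ⟪P x - P y, P x - P y⟫ ≤ ⟪x - y, P x - P y⟫ := by
    simp only [inner_sub_left, inner_sub_right] at h₁ h₂ ⊢
    linarith
  rw [real_inner_self_eq_norm_sq] at h₃
  have h₄ := real_inner_le_norm (x - y) (P x - P y)
  by_contra! h
  nlinarith [norm_nonneg (x - y), norm_nonneg (P x - P y)]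

/-- A point outside the open ball is projected to the sphere. -/
theorem norm_eq_of_projection_closedBall {E : Type*} [NormedAddCommGroup E]
    [InnerProductSpace ℝ E] {R : ℝ} (hR : 0 < R) {x p : E} (hx : R ≤ ‖x‖) (hp : ‖p‖ ≤ R)
    (h : ∀ y ∈ Metric.closedBall (0 : E) R, ⟪x - p, y - p⟫ ≤ 0) : ‖p‖ = R := by
  have hx0 : 0 < ‖x‖ := hR.trans_le hx
  have hq : (R / ‖x‖) • x ∈ Metric.closedBall (0 : E) R := by
    rw [mem_closedBall_zero_iff, norm_smul, norm_div, norm_norm, Real.norm_of_nonneg hR.le,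
      div_mul_cancel₀ _ hx0.ne']
  have h₁ := h _ hq
  simp only [inner_sub_left, inner_sub_right, inner_smul_right,
    real_inner_self_eq_norm_sq, real_inner_comm x p] at h₁
  have h₂ := real_inner_le_norm x p
  have h₃ : R / ‖x‖ * ‖x‖ ^ 2 = R * ‖x‖ := by field_simp
  have h₄ : R / ‖x‖ * ⟪x, p⟫ ≤ R * ‖p‖ := by
    calc R / ‖x‖ * ⟪x, p⟫ ≤ R / ‖x‖ * (‖x‖ * ‖p‖) := by gcongr
      _ = R * ‖p‖ := by field_simp
  by_contra hne
  have hlt : ‖p‖ < R := lt_of_le_of_ne hp hne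
  rw [mul_sub, h₃] at h₁
  nlinarith [mul_pos (sub_pos.2 hlt) (sub_pos.2 (hlt.trans_le hx))]

theorem exists_polynomial_eval_eq_det_id_add_smul {E : Type*} [NormedAddCommGroup E]
    [NormedSpace ℝ E] [FiniteDimensional ℝ E] (A : E →L[ℝ] E) :
    ∃ p : Polynomial ℝ, p.natDegree ≤ Module.finrank ℝ E ∧
      ∀ t : ℝ, (ContinuousLinearMap.id ℝ E + t • A).det = p.eval t := by
  let b := Module.finBasis ℝ E
  let M := LinearMap.toMatrix b b (A : E →ₗ[ℝ] E)
  refine ⟨((Polynomial.X : Polynomial ℝ) • M.map Polynomial.C +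
    (1 : Matrix (Fin _) (Fin _) ℝ).map Polynomial.C).det, ?_, fun t => ?_⟩
  · simpa using Polynomial.natDegree_det_X_add_C_le M 1
  · rw [← Polynomial.coe_evalRingHom, RingHom.map_det, ContinuousLinearMap.det,
      ← LinearMap.det_toMatrix b]
    congr 1
    ext i j
    have : ((ContinuousLinearMap.id ℝ E + t • A : E →L[ℝ] E) : E →ₗ[ℝ] E)
      = LinearMap.id + t • (A : E →ₗ[ℝ] E) := rfl
    rw [this, map_add, map_smul, LinearMap.toMatrix_id]
    by_cases hij : i = j <;> simp [M, hij] <;> ring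

/-- A small multiple of a Lipschitz field vanishing on the sphere perturbs the identity to a
bijection of the ball. -/
theorem injOn_and_image_ball_eq {E : Type*} [NormedAddCommGroup E]
    [InnerProductSpace ℝ E] [FiniteDimensional ℝ E] {v : E → E} {R : ℝ} (hR : 0 < R)
    {K : NNReal} (hv : LipschitzOnWith K v (Metric.closedBall 0 R))
    (hv0 : ∀ x, ‖x‖ = R → v x = 0) {t : ℝ} (ht : 0 ≤ t) (htK : t * K < 1) :
    InjOn (fun x => x + t • v x) (Metric.ball 0 R) ∧
      (fun x => x + t • v x) '' Metric.ball 0 R = Metric.ball 0 R := by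
  obtain ⟨P, hPX, hP, hPL⟩ := exists_convex_projection
    (X := Metric.closedBall (0 : E) R) (Metric.nonempty_closedBall.2 hR.le)
    (isCompact_closedBall _ _).isComplete (convex_closedBall _ _)
  have hPid : ∀ x ∈ Metric.ball (0 : E) R, P x = x := fun x hx => by
    have := hP x x (Metric.ball_subset_closedBall hx)
    rw [real_inner_self_nonpos, sub_eq_zero] at this
    exact this.symm
  have hw0 : ∀ x ∉ Metric.ball (0 : E) R, v (P x) = 0 := fun x hx =>
    hv0 _ (norm_eq_of_projection_closedBall hR (by simpa using hx) (by simpa using hPX x) (hP x))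
  have hw : ∀ x y, ‖v (P x) - v (P y)‖ ≤ K * ‖x - y‖ := fun x y => by
    have h₁ := hv.dist_le_mul _ (hPX x) _ (hPX y)
    have h₂ := hPL.dist_le_mul x y
    simp only [dist_eq_norm, NNReal.coe_one, one_mul] at h₁ h₂
    exact h₁.trans (by gcongr)
  have hinj : ∀ x y, x + t • v (P x) = y + t • v (P y) → x = y := fun x y h => by
    have h₁ : x - y = t • (v (P y) - v (P x)) := by
      rw [smul_sub, sub_eq_sub_iff_add_eq_add, h, add_comm]
    have h₂ : ‖x - y‖ ≤ t * K * ‖x - y‖ := by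
      calc ‖x - y‖ = t * ‖v (P y) - v (P x)‖ := by
            rw [h₁, norm_smul, Real.norm_of_nonneg ht]
        _ ≤ t * (K * ‖y - x‖) := by gcongr; exact hw y x
        _ = t * K * ‖x - y‖ := by rw [norm_sub_rev, mul_assoc]
    rw [← sub_eq_zero, ← norm_eq_zero]
    nlinarith [norm_nonneg (x - y)]
  refine ⟨fun x hx y hy h => hinj x y (by simpa only [hPid x hx, hPid y hy] using h),
    Subset.antisymm ?_ fun y hy => ?_⟩
  · rintro _ ⟨x, hx, rfl⟩
    by_contra hy
    have := hinj (x + t • v x) x (by rw [hw0 _ hy, hPid x hx]; simp)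
    dsimp only at hy
    rw [this] at hy
    exact hy hx
  · have hc : ContractingWith (⟨t, ht⟩ * K) fun x => y - t • v (P x) := by
      refine ⟨by exact_mod_cast htK, LipschitzWith.of_dist_le_mul fun a b => ?_⟩
      rw [dist_eq_norm, dist_eq_norm, sub_sub_sub_cancel_left, ← smul_sub, norm_smul,
        Real.norm_of_nonneg ht, norm_sub_rev a b]
      calc t * ‖v (P b) - v (P a)‖ ≤ t * (K * ‖b - a‖) := by gcongr; exact hw b a
        _ = _ := by rw [← mul_assoc]; rfl
    have hx : y - t • v (P (hc.fixedPoint)) = hc.fixedPoint := hc.fixedPoint_isFixedPt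
    set x := hc.fixedPoint
    have hxB : x ∈ Metric.ball (0 : E) R := by
      by_contra hn
      rw [hw0 x hn, smul_zero, sub_zero] at hx
      exact hn (hx ▸ hy)
    refine ⟨x, hxB, ?_⟩
    rw [hPid x hxB] at hx
    exact (sub_eq_iff_eq_add.1 hx).symm

/-- The Milnor–Rogers volume argument: a `C¹` perturbation of the identity fixing the sphere
pointwise is not everywhere singular on the ball. -/
theorem exists_det_id_add_fderiv_ne_zero {E : Type*} [NormedAddCommGroup E]
    [InnerProductSpace ℝ E] [FiniteDimensional ℝ E] {v : E → E} {R : ℝ} (hR : 0 < R)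
    (hv : ContDiff ℝ 1 v) (hv0 : ∀ x, ‖x‖ = R → v x = 0) :
    ∃ x ∈ Metric.ball (0 : E) R, (ContinuousLinearMap.id ℝ E + fderiv ℝ v x).det ≠ 0 := by
  let : MeasurableSpace E := borel E
  have : BorelSpace E := ⟨rfl⟩
  by_contra! hzero
  let J : ℝ → E → ℝ := fun t x => (ContinuousLinearMap.id ℝ E + t • fderiv ℝ v x).det
  have hJc : Continuous fun z : ℝ × E => J z.1 z.2 := by
    refine ContinuousLinearMap.continuous_det.comp ?_
    exact continuous_const.add
      (continuous_fst.smul ((hv.continuous_fderiv one_ne_zero).comp continuous_snd))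
  obtain ⟨K, hK⟩ := hv.locallyLipschitz.locallyLipschitzOn.exists_lipschitzOnWith_of_compact
    (isCompact_closedBall (0 : E) R)
  have hpos : ∀ᶠ t in 𝓝 (0 : ℝ), ∀ x ∈ Metric.closedBall (0 : E) R, 0 < J t x := by
    refine (isCompact_closedBall (0 : E) R).eventually_forall_of_forall_eventually fun x _ => ?_
    refine hJc.continuousAt.eventually (lt_mem_nhds ?_)
    simp [J, ContinuousLinearMap.det]
  have hsmall : ∀ᶠ t in 𝓝 (0 : ℝ), t * (K : ℝ) < 1 :=
    (continuous_mul_const (K : ℝ)).continuousAt.eventually_lt_const (by simp)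
  have hvol : ∀ᶠ t in 𝓝[>] (0 : ℝ),
      ∫ x in Metric.ball (0 : E) R, J t x = volume.real (Metric.ball (0 : E) R) := by
    filter_upwards [nhdsWithin_le_nhds hpos, nhdsWithin_le_nhds hsmall, self_mem_nhdsWithin]
      with t htpos htK ht
    obtain ⟨hinj, himg⟩ := injOn_and_image_ball_eq hR hK hv0 (le_of_lt ht) htK
    have h := integral_image_eq_integral_abs_det_fderiv_smul volume measurableSet_ball
      (f := fun x => x + t • v x)
      (f' := fun x => ContinuousLinearMap.id ℝ E + t • fderiv ℝ v x)
      (fun x _ => ((hasFDerivAt_id x).add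
        (((hv.differentiable one_ne_zero) x).hasFDerivAt.const_smul t)).hasFDerivWithinAt)
      hinj (fun _ => (1 : ℝ))
    rw [himg] at h
    simp only [setIntegral_const, smul_eq_mul, mul_one] at h
    rw [h]
    refine setIntegral_congr_fun measurableSet_ball fun x hx => ?_
    exact (abs_of_pos (htpos x (Metric.ball_subset_closedBall hx))).symm
  obtain ⟨ε, hε, hεvol⟩ := mem_nhdsGT_iff_exists_Ioo_subset.1 hvol
  obtain ⟨s, hsε, hscard⟩ :=
    (Ioo_infinite (mem_Ioi.1 hε)).exists_subset_card_eq (Module.finrank ℝ E + 1)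
  have hinterp : ∀ x, J 1 x = ∑ i ∈ s, J i x * (Lagrange.basis s id i).eval 1 := fun x => by
    obtain ⟨p, hp, hpJ⟩ := exists_polynomial_eval_eq_det_id_add_smul (fderiv ℝ v x)
    have hdeg : p.degree < s.card := by
      rw [hscard]
      exact (Polynomial.degree_le_of_natDegree_le hp).trans_lt (by exact_mod_cast Nat.lt_succ_self _)
    have h := congrArg (Polynomial.eval 1) (Lagrange.eq_interpolate (injOn_id _) hdeg)
    rw [Lagrange.interpolate_apply, Polynomial.eval_finsetSum] at h
    simpa only [J, hpJ, Polynomial.eval_mul, Polynomial.eval_C, id] using h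
  have hint : ∀ t, IntegrableOn (J t) (Metric.ball (0 : E) R) := fun t =>
    (((hJc.comp (Continuous.prodMk_right t)).continuousOn).integrableOn_compact
      (isCompact_closedBall (0 : E) R)).mono_set Metric.ball_subset_closedBall
  have hsum : ∑ i ∈ s, (Lagrange.basis s id i).eval (1 : ℝ) = 1 := by
    rw [← Polynomial.eval_finsetSum, Lagrange.sum_basis (injOn_id _)
      (Finset.card_pos.1 (by omega)), Polynomial.eval_one]
  have htotal : ∫ x in Metric.ball (0 : E) R, J 1 x = volume.real (Metric.ball (0 : E) R) := by
    simp only [hinterp]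
    rw [integral_finsetSum _ fun i _ => (hint i).mul_const _]
    simp only [integral_mul_const]
    rw [Finset.sum_congr rfl fun i hi => by rw [hεvol (hsε hi)], ← Finset.mul_sum, hsum, mul_one]
  rw [setIntegral_congr_fun measurableSet_ball (g := fun _ => (0 : ℝ))
    fun x hx => by simpa [J] using hzero x hx, integral_zero] at htotal
  exact (ENNReal.toReal_pos (Metric.measure_ball_pos volume (0 : E) hR).ne'
    measure_ball_lt_top.ne).ne htotal

/-- A `C¹` map equal to the identity on a sphere has a zero. -/
theorem ContDiff.exists_eq_zero_of_eqOn_sphere {E : Type*} [NormedAddCommGroup E]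
    [InnerProductSpace ℝ E] [FiniteDimensional ℝ E] {h : E → E} {R : ℝ} (hR : 0 < R)
    (hh : ContDiff ℝ 1 h) (hid : ∀ x, ‖x‖ = R → h x = x) : ∃ x, h x = 0 := by
  by_contra! hne
  let f : E → E := fun x => (R / ‖h x‖) • h x
  have hf : ContDiff ℝ 1 f :=
    (contDiff_const.div (hh.norm ℝ hne) fun x => norm_ne_zero_iff.2 (hne x)).smul hh
  have hfnorm : ∀ x, ‖f x‖ = R := fun x => by
    have := norm_ne_zero_iff.2 (hne x)
    simp only [f, norm_smul, norm_div, norm_norm, Real.norm_of_nonneg hR.le]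
    field_simp
  obtain ⟨x, -, hx⟩ := exists_det_id_add_fderiv_ne_zero hR (hf.sub contDiff_id) fun x hx => by
    simp [f, hid x hx, hx, hR.ne']
  have hfd : DifferentiableAt ℝ f x := hf.differentiable one_ne_zero x
  have hderiv : ContinuousLinearMap.id ℝ E + fderiv ℝ (f - id) x = fderiv ℝ f x := by
    rw [fderiv_sub hfd differentiableAt_id, fderiv_id, add_sub_cancel]
  change (ContinuousLinearMap.id ℝ E + fderiv ℝ (f - id) x).det ≠ 0 at hx
  rw [hderiv] at hx
  obtain ⟨u, hu⟩ := (LinearMap.equivOfDetNeZero _ hx).surjective (f x)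
  have hu' : fderiv ℝ f x u = f x := hu
  have hconst : HasFDerivAt (fun y => ⟪f y, f y⟫) (0 : E →L[ℝ] ℝ) x := by
    simp only [real_inner_self_eq_norm_sq, hfnorm]
    exact hasFDerivAt_const _ _
  have h₀ := DFunLike.congr_fun
    (hconst.unique (hfd.hasFDerivAt.inner ℝ hfd.hasFDerivAt)) u
  simp [hu', hfnorm] at h₀
  nlinarith

/-- **Brouwer's fixed point theorem** for bounded continuous self-maps of a Euclidean space. -/
theorem Continuous.exists_isFixedPt_of_norm_lt {E : Type*} [NormedAddCommGroup E]
    [InnerProductSpace ℝ E] [FiniteDimensional ℝ E] {g : E → E} (hg : Continuous g) {M : ℝ}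
    (hM : ∀ x, ‖g x‖ < M) : ∃ x, g x = x := by
  by_contra! hne
  have hM0 : 0 < M := (norm_nonneg _).trans_lt (hM 0)
  let t : E → Set E := fun x =>
    {y | ‖y‖ < M ∧ (‖x‖ ≤ M → ‖y - g x‖ < ‖x - g x‖) ∧ (2 * M ≤ ‖x‖ → y = 0)}
  have htconv : ∀ x, Convex ℝ (t x) := fun x => by
    have h₁ : Convex ℝ {y : E | ‖y‖ < M} := by
      simpa [Metric.ball, dist_eq_norm] using convex_ball (0 : E) M
    have h₂ : Convex ℝ {y : E | ‖x‖ ≤ M → ‖y - g x‖ < ‖x - g x‖} := by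
      by_cases hx : ‖x‖ ≤ M
      · simpa [hx, Metric.ball, dist_eq_norm] using convex_ball (g x) ‖x - g x‖
      · simp [hx, convex_univ]
    have h₃ : Convex ℝ {y : E | 2 * M ≤ ‖x‖ → y = 0} := by
      by_cases hx : 2 * M ≤ ‖x‖
      · simp [hx]
      · simp [hx, convex_univ]
    exact h₁.inter (h₂.inter h₃)
  have htloc : ∀ x, ∃ c, ∀ᶠ y in 𝓝 x, c ∈ t y := fun x => by
    rcases lt_or_ge ‖x‖ (2 * M) with hx | hx
    · refine ⟨g x, ?_⟩
      have h₁ : ∀ᶠ y in 𝓝 x, ‖g x - g y‖ < ‖y - g y‖ := by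
        refine (isOpen_lt (by fun_prop) (by fun_prop)).mem_nhds ?_
        simpa [sub_eq_zero] using (hne x).symm
      have h₂ : ∀ᶠ y in 𝓝 x, ‖y‖ < 2 * M := continuous_norm.continuousAt.eventually_lt_const hx
      filter_upwards [h₁, h₂] with y hy₁ hy₂
      exact ⟨hM x, fun _ => hy₁, fun h => absurd h hy₂.not_ge⟩
    · refine ⟨0, ?_⟩
      have h₁ : ∀ᶠ y in 𝓝 x, M < ‖y‖ :=
        continuous_norm.continuousAt.eventually_const_lt (by linarith)
      filter_upwards [h₁] with y hy
      exact ⟨by simpa using hM0, fun h => absurd h hy.not_ge, fun _ => rfl⟩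
  obtain ⟨G, hG⟩ := exists_contMDiffMap_forall_mem_convex_of_local_const
    (modelWithCornersSelf ℝ E) (n := 1) htconv htloc
  have hGc : ContDiff ℝ 1 G := by exact_mod_cast G.contMDiff.contDiff
  obtain ⟨x, hx⟩ := ContDiff.exists_eq_zero_of_eqOn_sphere (R := 2 * M) (by positivity)
    (contDiff_id.sub hGc) fun x hx => by simp [(hG x).2.2 hx.ge]
  have hx' : x = G x := sub_eq_zero.1 hx
  obtain ⟨h₁, h₂, -⟩ := hG x
  rw [← hx'] at h₁ h₂
  exact lt_irrefl _ (h₂ h₁.le)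

/-- If `F` is continuous and `X` is a nonempty compact convex subset of a
finite-dimensional real inner product space, then `VI(X, F)` has at least one solution. -/
theorem stmt_2
    {E : Type*} [NormedAddCommGroup E] [InnerProductSpace ℝ E] [FiniteDimensional ℝ E]
    (X : Set E) (hXne : X.Nonempty) (hXcp : IsCompact X) (hXcv : Convex ℝ X)
    (F : E → E) (hF : Continuous F) :
    ∃ xs ∈ X, ∀ x ∈ X, ⟪F xs, x - xs⟫ ≥ 0 := by
  obtain ⟨P, hPX, hP, hPL⟩ := exists_convex_projection hXne hXcp.isComplete hXcv
  obtain ⟨M, hM⟩ := hXcp.isBounded.exists_norm_le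
  obtain ⟨x, hx⟩ := Continuous.exists_isFixedPt_of_norm_lt (g := fun x => P (x - F x))
    (hPL.continuous.comp (continuous_id.sub hF)) (M := M + 1)
    fun x => (hM _ (hPX _)).trans_lt (lt_add_one M)
  refine ⟨x, hx ▸ hPX _, fun y hy => ?_⟩
  have h := hP (x - F x) y hy
  rw [show P (x - F x) = x from hx, sub_sub_cancel_left, inner_neg_left] at h
  linarith
end

section
/- If the bifunction f is (α,β)-regular with α > 0, then for every x ∈ X the function f_x attains a unique minimizer over X, and the resulting map T : X → X, T(x) = argmin_{x'∈X} f_x(x'), is (β/α)-Lipschitz: ‖T(x) − T(y)‖ ≤ (β/α)·‖x−y‖ for all x, y ∈ X. -/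
open RealInnerProductSpace

/-- First-order lower bound for a strongly convex function. -/
lemma StrongConvexOn.add_inner_add_le {E : Type*} [NormedAddCommGroup E]
    [InnerProductSpace ℝ E] [CompleteSpace E] {s : Set E} {m : ℝ} {f : E → ℝ} {g u v : E}
    (hf : StrongConvexOn s m f) (hg : HasGradientAt f g u) (hu : u ∈ s) (hv : v ∈ s) :
    f u + ⟪g, v - u⟫ + m / 2 * ‖v - u‖ ^ 2 ≤ f v := by
  have hline : HasDerivAt (fun t : ℝ => f (u + t • (v - u))) ⟪g, v - u⟫ 0 := by
    have hl : HasDerivAt (fun t : ℝ => u + t • (v - u)) (v - u) 0 := by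
      simpa using ((hasDerivAt_id (0 : ℝ)).smul_const (v - u)).const_add u
    have hg' : HasFDerivAt f (InnerProductSpace.toDual ℝ E g) (u + (0 : ℝ) • (v - u)) := by
      simpa using hg.hasFDerivAt
    simpa [Function.comp_def] using hg'.comp_hasDerivAt (0 : ℝ) hl
  have hslope := hline.tendsto_slope_zero_right
  have hbound : Filter.Tendsto (fun t : ℝ => f v - f u - (1 - t) * (m / 2 * ‖v - u‖ ^ 2))
      (nhdsWithin 0 (Set.Ioi 0)) (nhds (f v - f u - (1 - 0) * (m / 2 * ‖v - u‖ ^ 2))) :=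
    (Continuous.tendsto (by fun_prop) _).mono_left nhdsWithin_le_nhds
  have hle := le_of_tendsto_of_tendsto hslope hbound <| by
    filter_upwards [Ioo_mem_nhdsGT (zero_lt_one' ℝ)] with t ht
    have h := hf.2 hu hv (sub_nonneg.2 ht.2.le) ht.1.le (by ring)
    have hpt : (1 - t) • u + t • v = u + t • (v - u) := by module
    simp only [hpt, smul_eq_mul, norm_sub_rev u v] at h
    simp only [zero_add, zero_smul, add_zero, smul_eq_mul]
    rw [inv_mul_le_iff₀ ht.1]
    linarith
  linarith

/-- The first-order optimality condition at a minimizer over a convex set. -/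
lemma IsMinOn.inner_gradient_nonneg {E : Type*} [NormedAddCommGroup E]
    [InnerProductSpace ℝ E] [CompleteSpace E] {s : Set E} {f : E → ℝ} {g u v : E}
    (h : IsMinOn f s u) (hs : Convex ℝ s) (hg : HasGradientAt f g u) (hu : u ∈ s)
    (hv : v ∈ s) : 0 ≤ ⟪g, v - u⟫ := by
  simpa using h.localize.hasFDerivWithinAt_nonneg hg.hasFDerivAt.hasFDerivWithinAt
    (sub_mem_posTangentConeAt_of_segment_subset (hs.segment_subset hu hv))

/-- If `f` is `(α,β)`-regular with `α > 0`, then every `f_x` attains a unique minimizer over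
`X`, and the resulting argmin map `T` is `(β/α)`-Lipschitz on `X`. -/
theorem stmt_4
    {E : Type*} [NormedAddCommGroup E] [InnerProductSpace ℝ E] [FiniteDimensional ℝ E]
    (X : Set E) (hXne : X.Nonempty) (hXcp : IsCompact X) (hXcv : Convex ℝ X)
    (f : E → E → ℝ) (f' : E → E → E) (α β : ℝ) (hα : 0 < α)
    (hgrad : ∀ x ∈ X, ∀ x' ∈ X, HasGradientAt (f x) (f' x x') x')
    (hsc : ∀ x ∈ X, StrongConvexOn X α (f x))
    (hlip : ∀ x' ∈ X, ∀ x ∈ X, ∀ y ∈ X, ‖f' x x' - f' y x'‖ ≤ β * ‖x - y‖) :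
    ∃ T : E → E,
      (∀ x ∈ X, T x ∈ X ∧ IsMinOn (f x) X (T x) ∧
        ∀ z ∈ X, IsMinOn (f x) X z → z = T x) ∧
      (∀ x ∈ X, ∀ y ∈ X, ‖T x - T y‖ ≤ (β / α) * ‖x - y‖) := by
  have hex : ∀ x, ∃ z, x ∈ X → z ∈ X ∧ IsMinOn (f x) X z := by
    intro x
    by_cases hx : x ∈ X
    · obtain ⟨z, hz, hmin⟩ := hXcp.exists_isMinOn hXne
        (fun z hz => (hgrad x hx z hz).continuousAt.continuousWithinAt)
      exact ⟨z, fun _ => ⟨hz, hmin⟩⟩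
    · exact ⟨x, fun h => absurd h hx⟩
  choose T hT using hex
  refine ⟨T, fun x hx => ⟨(hT x hx).1, (hT x hx).2, fun z hz hmin => ?_⟩, fun x hx y hy => ?_⟩
  · exact ((hsc x hx).strictConvexOn hα).eq_of_isMinOn hmin (hT x hx).2 hz (hT x hx).1
  · obtain ⟨ha, hamin⟩ := hT x hx
    obtain ⟨hb, hbmin⟩ := hT y hy
    have h1 := (hsc x hx).add_inner_add_le (hgrad x hx _ ha) ha hb
    have h2 := (hsc x hx).add_inner_add_le (hgrad x hx _ hb) hb ha
    have h3 := hamin.inner_gradient_nonneg hXcv (hgrad x hx _ ha) ha hb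
    have h4 := hbmin.inner_gradient_nonneg hXcv (hgrad y hy _ hb) hb ha
    have h5 := real_inner_le_norm (f' y (T y) - f' x (T y)) (T x - T y)
    have h6 := hlip _ hb y hy x hx
    rw [inner_sub_left] at h5
    rw [norm_sub_rev (T y)] at h1
    rw [norm_sub_rev y] at h6
    have h7 : α * ‖T x - T y‖ * ‖T x - T y‖ ≤ β * ‖x - y‖ * ‖T x - T y‖ := by
      have := mul_le_mul_of_nonneg_right h6 (norm_nonneg (T x - T y))
      linarith
    rw [div_mul_eq_mul_div, le_div_iff₀' hα]
    rcases (norm_nonneg (T x - T y)).eq_or_lt with h0 | h0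
    · rw [← h0, mul_zero]
      exact (norm_nonneg _).trans h6
    · exact le_of_mul_le_mul_right h7 h0
end

section
/- If the bifunction f is (α,β)-regular with α > β > 0, then there exists a unique point x* ∈ X that is optimal for its own induced loss: f_{x*}(x*) = min_{x∈X} f_{x*}(x), i.e. the argmin map T(x) = argmin_{x'∈X} f_x(x') has a unique fixed point in X. -/
open RealInnerProductSpace

/-- First-order lower bound for a strongly convex function at a point of differentiability. -/
theorem StrongConvexOn.add_inner_add_sq_le
    {E : Type*} [NormedAddCommGroup E] [InnerProductSpace ℝ E] [CompleteSpace E]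
    {X : Set E} {g : E → ℝ} {α : ℝ} {a b v : E} (hg : StrongConvexOn X α g)
    (ha : a ∈ X) (hb : b ∈ X) (hv : HasGradientAt g v a) :
    g a + inner ℝ v (b - a) + α / 2 * ‖b - a‖ ^ 2 ≤ g b := by
  have hline : HasDerivAt (fun t : ℝ ↦ a + t • (b - a)) (b - a) 0 := by
    simpa using ((hasDerivAt_id (0 : ℝ)).smul_const (b - a)).const_add a
  have hder : HasDerivAt (fun t : ℝ ↦ g (a + t • (b - a))) (inner ℝ v (b - a)) 0 := by
    have hv0 : HasFDerivAt g (InnerProductSpace.toDual ℝ E v) (a + (0 : ℝ) • (b - a)) := by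
      simpa using hv.hasFDerivAt
    simpa [Function.comp_def] using hv0.comp_hasDerivAt (0 : ℝ) hline
  have hlim := (hasDerivAt_iff_tendsto_slope_zero.1 hder).mono_left
    (nhdsWithin_mono (0 : ℝ) fun t (ht : t ∈ Set.Ioi (0 : ℝ)) ↦ ne_of_gt ht)
  have hbound : Filter.Tendsto
      (fun t : ℝ ↦ g b - g a - (1 - t) * (α / 2 * ‖b - a‖ ^ 2)) (nhdsWithin 0 (Set.Ioi 0))
      (nhds (g b - g a - (1 - 0) * (α / 2 * ‖b - a‖ ^ 2))) :=
    (Continuous.tendsto (by fun_prop) (0 : ℝ)).mono_left nhdsWithin_le_nhds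
  have hle := le_of_tendsto_of_tendsto hlim hbound (by
    filter_upwards [Ioo_mem_nhdsGT (zero_lt_one' ℝ)] with t ht
    have h := hg.2 ha hb (sub_nonneg.2 ht.2.le) ht.1.le (sub_add_cancel 1 t)
    have hcomb : (1 - t) • a + t • b = a + t • (b - a) := by module
    rw [hcomb, norm_sub_rev a b] at h
    simp only [smul_eq_mul] at h
    simp only [zero_add, zero_smul, add_zero, smul_eq_mul]
    rw [inv_mul_le_iff₀ ht.1]
    linarith)
  linarith

/-- The gradient at a minimizer over a convex set satisfies the variational inequality. -/
theorem IsMinOn.inner_gradient_nonneg_s5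
    {E : Type*} [NormedAddCommGroup E] [InnerProductSpace ℝ E] [CompleteSpace E]
    {X : Set E} {g : E → ℝ} {a b v : E} (hX : Convex ℝ X) (hmin : IsMinOn g X a)
    (ha : a ∈ X) (hb : b ∈ X) (hv : HasGradientAt g v a) : 0 ≤ inner ℝ v (b - a) := by
  simpa using hmin.localize.hasFDerivWithinAt_nonneg hv.hasFDerivAt.hasFDerivWithinAt
    (sub_mem_posTangentConeAt_of_segment_subset (hX.segment_subset ha hb))

/-- Minimizers of two strongly convex functions are close when the gradients are close. -/
theorem StrongConvexOn.mul_norm_sub_le_of_isMinOn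
    {E : Type*} [NormedAddCommGroup E] [InnerProductSpace ℝ E] [CompleteSpace E]
    {X : Set E} {g h : E → ℝ} {α : ℝ} {p q u v w : E} (hX : Convex ℝ X)
    (hh : StrongConvexOn X α h) (hp : p ∈ X) (hq : q ∈ X)
    (hgp : IsMinOn g X p) (hhq : IsMinOn h X q)
    (hu : HasGradientAt g u p) (hv : HasGradientAt h v p) (hw : HasGradientAt h w q) :
    α * ‖p - q‖ ≤ ‖u - v‖ := by
  have h1 := hgp.inner_gradient_nonneg_s5 hX hp hq hu
  have h2 := hhq.inner_gradient_nonneg_s5 hX hq hp hw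
  have h3 := hh.add_inner_add_sq_le hp hq hv
  have h4 := hh.add_inner_add_sq_le hq hp hw
  have h5 := real_inner_le_norm (u - v) (q - p)
  rw [inner_sub_left] at h5
  rw [norm_sub_rev q p] at h3 h5
  rcases (norm_nonneg (p - q)).eq_or_lt with h0 | h0
  · rw [← h0, mul_zero]
    exact norm_nonneg _
  · refine le_of_mul_le_mul_right ?_ h0
    nlinarith

/-- If `f` is `(α,β)`-regular with `α > β > 0`, then there is a unique point `x* ∈ X` that is
optimal for its own induced loss: `f_{x*}(x*) = min_{x ∈ X} f_{x*}(x)`. -/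
theorem stmt_5
    {E : Type*} [NormedAddCommGroup E] [InnerProductSpace ℝ E] [FiniteDimensional ℝ E]
    (X : Set E) (hXne : X.Nonempty) (hXcp : IsCompact X) (hXcv : Convex ℝ X)
    (f : E → E → ℝ) (f' : E → E → E) (α β : ℝ) (hβ : 0 < β) (hαβ : β < α)
    (hgrad : ∀ x ∈ X, ∀ x' ∈ X, HasGradientAt (f x) (f' x x') x')
    (hsc : ∀ x ∈ X, StrongConvexOn X α (f x))
    (hlip : ∀ x' ∈ X, ∀ x ∈ X, ∀ y ∈ X, ‖f' x x' - f' y x'‖ ≤ β * ‖x - y‖) :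
    ∃! xs, xs ∈ X ∧ IsMinOn (f xs) X xs := by
  have hα : 0 < α := hβ.trans hαβ
  have hstab : ∀ x ∈ X, ∀ y ∈ X, ∀ p ∈ X, ∀ q ∈ X, IsMinOn (f x) X p → IsMinOn (f y) X q →
      α * ‖p - q‖ ≤ β * ‖x - y‖ := fun x hx y hy p hp q hq hxp hyq ↦
    ((hsc y hy).mul_norm_sub_le_of_isMinOn hXcv hp hq hxp hyq (hgrad x hx p hp)
      (hgrad y hy p hp) (hgrad y hy q hq)).trans (hlip p hp x hx y hy)
  have hex : ∀ x : X, ∃ p : X, IsMinOn (f x) X p := fun x ↦ by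
    obtain ⟨p, hp, hmin⟩ := hXcp.exists_isMinOn hXne
      (fun y hy ↦ (hgrad x x.2 y hy).hasFDerivAt.continuousAt.continuousWithinAt)
    exact ⟨⟨p, hp⟩, hmin⟩
  choose T hT using hex
  have hcontr : ContractingWith (β / α).toNNReal T := by
    refine ⟨Real.toNNReal_lt_one.2 ((div_lt_one hα).2 hαβ), LipschitzWith.of_dist_le_mul ?_⟩
    intro x y
    rw [Real.coe_toNNReal _ (div_pos hβ hα).le, Subtype.dist_eq, Subtype.dist_eq, dist_eq_norm,
      dist_eq_norm, div_mul_eq_mul_div, le_div_iff₀ hα, mul_comm]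
    exact hstab x x.2 y y.2 (T x) (T x).2 (T y) (T y).2 (hT x) (hT y)
  have : CompleteSpace X := hXcp.isComplete.completeSpace_coe
  have : Nonempty X := hXne.to_subtype
  obtain ⟨p, hfix⟩ : ∃ p : X, T p = p := ⟨hcontr.fixedPoint T, hcontr.fixedPoint_isFixedPt⟩
  have hmin : IsMinOn (f p) X p := by
    have h := hT p
    rwa [hfix] at h
  refine ⟨p, ⟨p.2, hmin⟩, ?_⟩
  rintro y ⟨hy, hymin⟩
  have h := hstab y hy p p.2 y hy p p.2 hymin hmin
  rw [← sub_eq_zero, ← norm_eq_zero]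
  nlinarith [norm_nonneg (y - (p : E))]
end

section
/- Let g : E → ℝ be α-strongly convex (α > 0) and differentiable on the nonempty compact convex set X, let h : E → ℝ be differentiable, and let x* ∈ X satisfy ⟨∇h(x*), x − x*⟩ ≥ 0 for all x ∈ X. Then g(x*) − min_{x∈X} g(x) ≤ ‖∇g(x*) − ∇h(x*)‖² / (2α). -/
open RealInnerProductSpace

/-- If `g` is `α`-strongly convex and differentiable on `X`, `h` is differentiable, and
`x*` satisfies the first-order condition `⟪∇h(x*), x − x*⟫ ≥ 0` on `X`, then
`g(x*) − min_X g ≤ ‖∇g(x*) − ∇h(x*)‖² / (2α)`. -/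
theorem stmt_9
    {E : Type*} [NormedAddCommGroup E] [InnerProductSpace ℝ E] [FiniteDimensional ℝ E]
    (X : Set E) (hXne : X.Nonempty) (hXcp : IsCompact X) (hXcv : Convex ℝ X)
    (g h : E → ℝ) (g' h' : E → E) (α : ℝ) (hα : 0 < α)
    (hg : ∀ x ∈ X, HasGradientAt g (g' x) x)
    (hh : ∀ x ∈ X, HasGradientAt h (h' x) x)
    -- `g` is `α`-strongly convex on `X` (first-order characterization)
    (hsc : ∀ x ∈ X, ∀ y ∈ X, g y ≥ g x + ⟪g' x, y - x⟫ + α / 2 * ‖y - x‖ ^ 2)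
    (xs : E) (hxs : xs ∈ X)
    (hVI : ∀ x ∈ X, ⟪h' xs, x - xs⟫ ≥ 0) :
    g xs - sInf (g '' X) ≤ ‖g' xs - h' xs‖ ^ 2 / (2 * α) := by
  suffices hlow : g xs - ‖g' xs - h' xs‖ ^ 2 / (2 * α) ≤ sInf (g '' X) by linarith
  refine le_csInf (hXne.image g) ?_
  rintro _ ⟨y, hy, rfl⟩
  have hconv := hsc xs hxs y hy
  have hvi := hVI y hy
  have hcs := neg_le_of_abs_le (abs_real_inner_le_norm (g' xs - h' xs) (y - xs))
  rw [inner_sub_left] at hcs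
  have hyoung : ‖g' xs - h' xs‖ * ‖y - xs‖ - α / 2 * ‖y - xs‖ ^ 2
      ≤ ‖g' xs - h' xs‖ ^ 2 / (2 * α) := by
    rw [le_div_iff₀ (by positivity)]
    nlinarith [sq_nonneg (‖g' xs - h' xs‖ - α * ‖y - xs‖)]
  linarith
end

section
/- Let g : E → ℝ be convex and differentiable on the nonempty compact convex set X with diameter D_X = max_{x,x'∈X} ‖x−x'‖, let h : E → ℝ be differentiable, and let x* ∈ X satisfy ⟨∇h(x*), x − x*⟩ ≥ 0 for all x ∈ X. Then g(x*) − min_{x∈X} g(x) ≤ ‖∇g(x*) − ∇h(x*)‖ · D_X. -/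
open RealInnerProductSpace

/-- First-order inequality: a convex function lies above its tangent hyperplanes. -/
theorem ConvexOn.inner_gradient_le_sub {E : Type*} [NormedAddCommGroup E]
    [InnerProductSpace ℝ E] [CompleteSpace E] {s : Set E} {f : E → ℝ} {f' x y : E}
    (hf : ConvexOn ℝ s f) (hx : x ∈ s) (hy : y ∈ s) (hf' : HasGradientAt f f' x) :
    ⟪f', y - x⟫ ≤ f y - f x := by
  have hline : ConvexOn ℝ (AffineMap.lineMap x y ⁻¹' s) (f ∘ AffineMap.lineMap (k := ℝ) x y) :=
    hf.comp_affineMap _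
  have hderiv : HasDerivAt (f ∘ AffineMap.lineMap (k := ℝ) x y) ⟪f', y - x⟫ 0 := by
    have hgrad : HasFDerivAt f (InnerProductSpace.toDual ℝ E f')
        (AffineMap.lineMap (k := ℝ) x y 0) := by
      simpa using hf'.hasFDerivAt
    simpa using hgrad.comp_hasDerivAt (0 : ℝ) AffineMap.hasDerivAt_lineMap
  simpa [slope_def_field] using
    hline.le_slope_of_hasDerivAt (x := 0) (y := 1) (by simpa) (by simpa) one_pos hderiv

/-- If `g` is convex and differentiable on `X` with diameter `D_X`, `h` is differentiable,
and `x*` satisfies `⟪∇h(x*), x − x*⟫ ≥ 0` on `X`, then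
`g(x*) − min_X g ≤ ‖∇g(x*) − ∇h(x*)‖ · D_X`. -/
theorem stmt_10
    {E : Type*} [NormedAddCommGroup E] [InnerProductSpace ℝ E] [FiniteDimensional ℝ E]
    (X : Set E) (hXne : X.Nonempty) (hXcp : IsCompact X) (hXcv : Convex ℝ X)
    (g h : E → ℝ) (g' h' : E → E)
    (hg : ∀ x ∈ X, HasGradientAt g (g' x) x)
    (hh : ∀ x ∈ X, HasGradientAt h (h' x) x)
    (hcv : ConvexOn ℝ X g)
    (xs : E) (hxs : xs ∈ X)
    (hVI : ∀ x ∈ X, ⟪h' xs, x - xs⟫ ≥ 0) :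
    g xs - sInf (g '' X) ≤ ‖g' xs - h' xs‖ * Metric.diam X := by
  have hle : ∀ x ∈ X, g xs - ‖g' xs - h' xs‖ * Metric.diam X ≤ g x := by
    intro x hx
    have hgrad := hcv.inner_gradient_le_sub hxs hx (hg xs hxs)
    have hcs : -⟪g' xs - h' xs, x - xs⟫ ≤ ‖g' xs - h' xs‖ * ‖x - xs‖ :=
      (neg_le_abs _).trans (abs_real_inner_le_norm _ _)
    have hdiam : ‖g' xs - h' xs‖ * ‖x - xs‖ ≤ ‖g' xs - h' xs‖ * Metric.diam X := by
      gcongr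
      rw [← dist_eq_norm]
      exact Metric.dist_le_diam_of_mem hXcp.isBounded hx hxs
    rw [inner_sub_left] at hcs
    linarith [hVI x hx]
  have hinf := le_csInf (hXne.image g) (Set.forall_mem_image.2 hle)
  linarith
end

section
/- Let F : E → E be μ-strongly monotone (μ > 0) and L'-Lipschitz on the nonempty closed convex set X, let x* ∈ X solve the variational inequality ⟨F(x*), x − x*⟩ ≥ 0 for all x ∈ X, and let η > 0. If x' = P_X(x − η·F(x)) for some x ∈ X, where P_X is the Euclidean projection onto X, then ‖x' − x*‖² ≤ (1 + L'²η² − 2μη)·‖x − x*‖². -/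
open RealInnerProductSpace

/-- The variational characterization of a nearest point of a convex set. -/
theorem inner_sub_sub_nonpos_of_isMinOn_norm_sub
    {E : Type*} [NormedAddCommGroup E] [InnerProductSpace ℝ E] {X : Set E} (hX : Convex ℝ X)
    {u v : E} (hv : v ∈ X) (hmin : IsMinOn (fun z => ‖z - u‖) X v) {w : E} (hw : w ∈ X) :
    ⟪u - v, w - v⟫ ≤ 0 := by
  refine (norm_eq_iInf_iff_real_inner_le_zero hX hv).1 ?_ w hw
  have : Nonempty X := ⟨⟨v, hv⟩⟩
  refine le_antisymm (le_ciInf fun z => ?_) (ciInf_le ⟨0, ?_⟩ (⟨v, hv⟩ : X))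
  · rw [norm_sub_rev u v, norm_sub_rev u z]
    exact hmin z.2
  · rintro _ ⟨z, rfl⟩
    exact norm_nonneg _

/-- One step of projected gradient for a `μ`-strongly monotone, `L'`-Lipschitz map `F` is a
contraction towards the VI solution `x*`: if `x' = P_X(x − η·F(x))` then
`‖x' − x*‖² ≤ (1 + L'²η² − 2μη)·‖x − x*‖²`. -/
theorem stmt_14
    {E : Type*} [NormedAddCommGroup E] [InnerProductSpace ℝ E] [FiniteDimensional ℝ E]
    (X : Set E) (hXne : X.Nonempty) (hXcl : IsClosed X) (hXcv : Convex ℝ X)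
    (F : E → E) (μ L' : ℝ) (hμ : 0 < μ)
    (hmono : ∀ x ∈ X, ∀ y ∈ X, ⟪F x - F y, x - y⟫ ≥ μ * ‖x - y‖ ^ 2)
    (hlip : ∀ x ∈ X, ∀ y ∈ X, ‖F x - F y‖ ≤ L' * ‖x - y‖)
    (xs : E) (hxs : xs ∈ X)
    (hVI : ∀ x ∈ X, ⟪F xs, x - xs⟫ ≥ 0)
    (η : ℝ) (hη : 0 < η)
    (x x' : E) (hx : x ∈ X)
    -- `x'` is the Euclidean projection of `x − η·F(x)` onto `X`
    (hx' : x' ∈ X ∧ IsMinOn (fun z => ‖z - (x - η • F x)‖) X x') :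
    ‖x' - xs‖ ^ 2 ≤ (1 + L' ^ 2 * η ^ 2 - 2 * μ * η) * ‖x - xs‖ ^ 2 := by
  have hproj := inner_sub_sub_nonpos_of_isMinOn_norm_sub hXcv hx'.1 hx'.2 hxs
  have hsol := mul_nonneg hη.le (hVI x' hx'.1)
  have hm := mul_le_mul_of_nonneg_left (hmono x hx xs hxs) hη.le
  have hl : ‖F x - F xs‖ ^ 2 ≤ (L' * ‖x - xs‖) ^ 2 :=
    pow_le_pow_left₀ (norm_nonneg _) (hlip x hx xs hxs) 2
  have hl' := mul_le_mul_of_nonneg_left hl (sq_nonneg η)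
  have key : ‖x' - xs‖ ^ 2 ≤ ⟪(x - xs) - η • (F x - F xs), x' - xs⟫ := by
    have hid : ⟪(x - xs) - η • (F x - F xs), x' - xs⟫ =
        ‖x' - xs‖ ^ 2 - ⟪x - η • F x - x', xs - x'⟫ + η * ⟪F xs, x' - xs⟫ := by
      rw [← real_inner_self_eq_norm_sq, ← neg_sub x' xs, inner_neg_right, sub_neg_eq_add,
        ← real_inner_smul_left, ← inner_add_left, ← inner_add_left]
      congr 1
      module
    linarith
  have hyoung := norm_sub_sq_real ((x - xs) - η • (F x - F xs)) (x' - xs)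
  have hnonneg := sq_nonneg ‖(x - xs) - η • (F x - F xs) - (x' - xs)‖
  have hexp : ‖(x - xs) - η • (F x - F xs)‖ ^ 2 =
      ‖x - xs‖ ^ 2 - 2 * (η * ⟪F x - F xs, x - xs⟫) + η ^ 2 * ‖F x - F xs‖ ^ 2 := by
    rw [norm_sub_sq_real, real_inner_smul_right, real_inner_comm, norm_smul, mul_pow,
      Real.norm_eq_abs, sq_abs]
  linarith
end

section
/- (Constant dynamic regret of online gradient descent in COL) Suppose f is (α,β)-regular with α > β, for every x ∈ X the gradient map x' ↦ ∇f_x(x') is L-Lipschitz on X, and ‖∇f_x(x)‖ ≤ G on X. Let x* ∈ X be the unique solution of the variational inequality for F(x) = ∇f_x(x), let μ = α − β, and let 0 < η < 2μ/(L+β)². Then the online gradient descent iterates x_{n+1} = P_X(x_n − η·∇f_{x_n}(x_n)) satisfy: there exists a constant C < ∞ (independent of N) such that Regret^d_N ≤ C for all N; in particular the dynamic regret is O(1). -/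
open RealInnerProductSpace

section ProjectedGradient

variable {E : Type*} [NormedAddCommGroup E] [InnerProductSpace ℝ E]

/-- The first-order lower bound for a strongly convex function. -/
theorem StrongConvexOn.inner_add_le_sub [CompleteSpace E] {X : Set E} {α : ℝ} {g : E → ℝ}
    (hg : StrongConvexOn X α g) {y z g' : E} (hz : z ∈ X) (hy : y ∈ X)
    (hgrad : HasGradientAt g g' z) :
    ⟪g', y - z⟫ + α / 2 * ‖y - z‖ ^ 2 ≤ g y - g z := by
  have hslope : Filter.Tendsto (fun t : ℝ => t⁻¹ • (g (z + t • (y - z)) - g z))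
      (nhdsWithin 0 (Set.Ioi 0)) (nhds ⟪g', y - z⟫) := by
    have hline : HasLineDerivAt ℝ g ⟪g', y - z⟫ z (y - z) := by
      simpa using hgrad.hasFDerivAt.hasLineDerivAt (y - z)
    exact hline.tendsto_slope_zero_right
  have hlower : Filter.Tendsto (fun t : ℝ => g y - g z - (1 - t) * (α / 2 * ‖y - z‖ ^ 2))
      (nhdsWithin 0 (Set.Ioi 0)) (nhds (g y - g z - α / 2 * ‖y - z‖ ^ 2)) := by
    have hcont : Continuous (fun t : ℝ => g y - g z - (1 - t) * (α / 2 * ‖y - z‖ ^ 2)) := by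
      fun_prop
    simpa using (hcont.tendsto 0).mono_left nhdsWithin_le_nhds
  have hle := le_of_tendsto_of_tendsto hslope hlower (by
    filter_upwards [Ioo_mem_nhdsGT (zero_lt_one' ℝ)] with t ⟨ht0, ht1⟩
    have hconv := hg.2 hy hz ht0.le (sub_nonneg.2 ht1.le) (by ring)
    have hpoint : t • y + (1 - t) • z = z + t • (y - z) := by module
    simp only [hpoint, smul_eq_mul] at hconv ⊢
    rw [inv_mul_le_iff₀ ht0]
    linarith)
  linarith

theorem StrongConvexOn.mul_sq_norm_le_inner [CompleteSpace E] {X : Set E} {α : ℝ} {g : E → ℝ}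
    (hg : StrongConvexOn X α g) {y z gy gz : E} (hy : y ∈ X) (hz : z ∈ X)
    (hgy : HasGradientAt g gy y) (hgz : HasGradientAt g gz z) :
    α * ‖y - z‖ ^ 2 ≤ ⟪gy - gz, y - z⟫ := by
  have hzy := hg.inner_add_le_sub hz hy hgz
  have hyz := hg.inner_add_le_sub hy hz hgy
  rw [← neg_sub y z, inner_neg_right, norm_neg] at hyz
  rw [inner_sub_left]
  linarith

theorem Convex.inner_sub_le_zero_of_isMinOn {X : Set E} (hX : Convex ℝ X) {w p z : E}
    (hp : p ∈ X) (hmin : IsMinOn (fun y => ‖y - w‖) X p) (hz : z ∈ X) :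
    ⟪w - p, z - p⟫ ≤ 0 := by
  refine (norm_eq_iInf_iff_real_inner_le_zero hX hp).1 ?_ z hz
  have : Nonempty X := ⟨⟨p, hp⟩⟩
  refine le_antisymm (le_ciInf fun y => ?_) (ciInf_le ⟨0, ?_⟩ (⟨p, hp⟩ : X))
  · simpa only [norm_sub_rev w] using isMinOn_iff.1 hmin y y.2
  · rintro _ ⟨y, rfl⟩
    exact norm_nonneg _

/-- The distance from the projected gradient step `p` to a solution `s` of a variational inequality
is at most that between the unprojected steps from `a` and from `s`. -/
theorem norm_sub_le_of_projected_step {X : Set E} (hX : Convex ℝ X) {a p s u v : E} {η : ℝ}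
    (hη : 0 ≤ η) (hs : s ∈ X) (hVI : ∀ y ∈ X, 0 ≤ ⟪v, y - s⟫) (hp : p ∈ X)
    (hmin : IsMinOn (fun y => ‖y - (a - η • u)‖) X p) :
    ‖p - s‖ ≤ ‖(a - s) - η • (u - v)‖ := by
  have hproj := hX.inner_sub_le_zero_of_isMinOn hp hmin hs
  have hvi := mul_nonneg hη (hVI p hp)
  have hsplit : ⟪(a - s) - η • (u - v), p - s⟫
      = ‖p - s‖ ^ 2 - ⟪a - η • u - p, s - p⟫ + η * ⟪v, p - s⟫ := by
    rw [← real_inner_self_eq_norm_sq, ← neg_sub p s, inner_neg_right, ← real_inner_smul_left,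
      sub_neg_eq_add, ← inner_add_left, ← inner_add_left]
    congr 1
    module
  have hcs := real_inner_le_norm ((a - s) - η • (u - v)) (p - s)
  by_contra! hlt
  nlinarith [norm_nonneg ((a - s) - η • (u - v))]

theorem norm_sub_smul_sq_le {d e : E} {η μ K : ℝ} (hη : 0 ≤ η)
    (hmono : μ * ‖d‖ ^ 2 ≤ ⟪e, d⟫) (hlip : ‖e‖ ≤ K * ‖d‖) :
    ‖d - η • e‖ ^ 2 ≤ (1 - 2 * η * μ + η ^ 2 * K ^ 2) * ‖d‖ ^ 2 := by
  have hsq : ‖e‖ ^ 2 ≤ K ^ 2 * ‖d‖ ^ 2 := by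
    rw [← mul_pow]
    exact pow_le_pow_left₀ (norm_nonneg _) hlip 2
  rw [norm_sub_sq_real, real_inner_smul_right, norm_smul, mul_pow, Real.norm_eq_abs, sq_abs,
    real_inner_comm]
  linarith [mul_le_mul_of_nonneg_left hmono hη, mul_le_mul_of_nonneg_left hsq (sq_nonneg η)]

theorem sum_Icc_le_of_contraction {d : ℕ → ℝ} {ρ : ℝ} (hρ : ρ < 1) (hd : ∀ n, 0 ≤ d n)
    (hstep : ∀ n ≥ 1, d (n + 1) ≤ ρ * d n) (N : ℕ) :
    ∑ n ∈ Finset.Icc 1 N, d n ≤ d 1 / (1 - ρ) := by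
  have htel : (∑ n ∈ Finset.Icc 1 N, d n) * (1 - ρ) ≤ d 1 - d (N + 1) := by
    induction N with
    | zero => simp
    | succ N ih =>
      rw [Finset.sum_Icc_succ_top (by omega)]
      linarith [hstep (N + 1) (by omega)]
  rw [le_div_iff₀ (sub_pos.2 hρ)]
  linarith [hd (N + 1)]

end ProjectedGradient

/-- Constant dynamic regret of online gradient descent in COL: under `(α,β)`-regularity
with `α > β`, `L`-Lipschitz gradients, bounded gradients, and stepsize
`0 < η < 2μ/(L+β)²` with `μ = α − β`, the iterates `x_{n+1} = P_X(x_n − η·∇f_{x_n}(x_n))`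
have dynamic regret bounded by a constant `C` independent of `N`. -/
theorem stmt_16
    {E : Type*} [NormedAddCommGroup E] [InnerProductSpace ℝ E] [FiniteDimensional ℝ E]
    (X : Set E) (hXne : X.Nonempty) (hXcp : IsCompact X) (hXcv : Convex ℝ X)
    (f : E → E → ℝ) (f' : E → E → E) (α β L G : ℝ) (hβ : 0 ≤ β) (hαβ : β < α)
    (hgrad : ∀ x ∈ X, ∀ x' ∈ X, HasGradientAt (f x) (f' x x') x')
    (hsc : ∀ x ∈ X, StrongConvexOn X α (f x))
    (hlipq : ∀ x' ∈ X, ∀ x ∈ X, ∀ y ∈ X, ‖f' x x' - f' y x'‖ ≤ β * ‖x - y‖)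
    (hlipd : ∀ x ∈ X, ∀ x' ∈ X, ∀ y' ∈ X, ‖f' x x' - f' x y'‖ ≤ L * ‖x' - y'‖)
    (hG : ∀ x ∈ X, ‖f' x x‖ ≤ G)
    -- `x*` is the unique solution of the variational inequality for `F(x) = ∇f_x(x)`
    (xs : E) (hxs : xs ∈ X)
    (hVI : ∀ x ∈ X, ⟪f' xs xs, x - xs⟫ ≥ 0)
    (hunique : ∀ y ∈ X, (∀ x ∈ X, ⟪f' y y, x - y⟫ ≥ 0) → y = xs)
    (η : ℝ) (hη0 : 0 < η) (hη : η < 2 * (α - β) / (L + β) ^ 2)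
    -- online gradient descent iterates
    (x : ℕ → E) (hx1 : x 1 ∈ X)
    (hstep : ∀ n ≥ 1, x (n + 1) ∈ X ∧
      IsMinOn (fun z => ‖z - (x n - η • f' (x n) (x n))‖) X (x (n + 1))) :
    ∃ C : ℝ, ∀ N : ℕ,
      ∑ n ∈ Finset.Icc 1 N, (f (x n) (x n) - sInf (f (x n) '' X)) ≤ C := by
  have hLip : ∀ y ∈ X, ‖f' y y - f' xs xs‖ ≤ (L + β) * ‖y - xs‖ := fun y hy => by
    linarith [norm_sub_le_norm_sub_add_norm_sub (f' y y) (f' y xs) (f' xs xs),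
      hlipd y hy y hy xs hxs, hlipq xs hxs y hy xs hxs]
  have hmono : ∀ y ∈ X, (α - β) * ‖y - xs‖ ^ 2 ≤ ⟪f' y y - f' xs xs, y - xs⟫ := fun y hy => by
    have hsame := (hsc y hy).mul_sq_norm_le_inner hy hxs (hgrad y hy y hy) (hgrad y hy xs hxs)
    have hcross := neg_le_of_abs_le (abs_real_inner_le_norm (f' y xs - f' xs xs) (y - xs))
    have hq := mul_le_mul_of_nonneg_right (hlipq xs hxs y hy xs hxs) (norm_nonneg (y - xs))
    have hsplit : ⟪f' y y - f' xs xs, y - xs⟫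
        = ⟪f' y y - f' y xs, y - xs⟫ + ⟪f' y xs - f' xs xs, y - xs⟫ := by
      rw [← inner_add_left, sub_add_sub_cancel]
    linarith
  have hxmem : ∀ n ≥ 1, x n ∈ X := fun n hn => by
    induction n, hn using Nat.le_induction with
    | base => exact hx1
    | succ n hn _ => exact (hstep n hn).1
  set q := 1 - 2 * η * (α - β) + η ^ 2 * (L + β) ^ 2
  have hq1 : q < 1 := by
    have hne : (L + β) ^ 2 ≠ 0 := fun h => by
      rw [h, div_zero] at hη
      exact hη.not_gt hη0
    have hlt := (lt_div_iff₀ (lt_of_le_of_ne (sq_nonneg _) hne.symm)).1 hη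
    linarith [mul_lt_mul_of_pos_left hlt hη0]
  have hρ1 : √q < 1 := by
    rw [Real.sqrt_lt' one_pos]
    simpa using hq1
  have hcontr : ∀ n ≥ 1, ‖x (n + 1) - xs‖ ≤ √q * ‖x n - xs‖ := fun n hn => by
    refine (norm_sub_le_of_projected_step hXcv hη0.le hxs hVI (hstep n hn).1
      (hstep n hn).2).trans ?_
    rw [← Real.sqrt_sq (norm_nonneg (x n - xs)), ← Real.sqrt_mul' _ (sq_nonneg _)]
    exact Real.le_sqrt_of_sq_le
      (norm_sub_smul_sq_le hη0.le (hmono _ (hxmem n hn)) (hLip _ (hxmem n hn)))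
  obtain ⟨D, hD⟩ := Metric.isBounded_iff.1 hXcp.isBounded
  have hterm : ∀ n ≥ 1, f (x n) (x n) - sInf (f (x n) '' X)
      ≤ (|L + β| * D + G) * ‖x n - xs‖ := fun n hn => by
    have hxn := hxmem n hn
    rw [sub_le_comm]
    refine le_csInf (hXne.image _) ?_
    rintro _ ⟨z, hz, rfl⟩
    have hα : 0 ≤ α / 2 * ‖z - x n‖ ^ 2 := by
      have : 0 < α := hβ.trans_lt hαβ
      positivity
    have hfirst := (hsc _ hxn).inner_add_le_sub hxn hz (hgrad _ hxn _ hxn)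
    have hsplit : ⟪f' (x n) (x n), z - x n⟫ = ⟪f' (x n) (x n) - f' xs xs, z - x n⟫
        + ⟪f' xs xs, z - xs⟫ - ⟪f' xs xs, x n - xs⟫ := by
      rw [add_sub_assoc, ← inner_sub_right, sub_sub_sub_cancel_right, ← inner_add_left,
        sub_add_cancel]
    have hdiam : ‖z - x n‖ ≤ D := by
      rw [← dist_eq_norm]
      exact hD hz hxn
    have hFdiff : ‖f' (x n) (x n) - f' xs xs‖ * ‖z - x n‖ ≤ |L + β| * ‖x n - xs‖ * D := by
      gcongr
      exact (hLip _ hxn).trans (by gcongr; exact le_abs_self _)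
    have hF : ‖f' xs xs‖ * ‖x n - xs‖ ≤ G * ‖x n - xs‖ := by
      gcongr
      exact hG xs hxs
    linarith [hVI z hz, real_inner_le_norm (f' xs xs) (x n - xs),
      neg_le_of_abs_le (abs_real_inner_le_norm (f' (x n) (x n) - f' xs xs) (z - x n))]
  have hK : 0 ≤ |L + β| * D + G := by
    have hD0 : 0 ≤ D := dist_nonneg.trans (hD hxs hxs)
    have hG0 : 0 ≤ G := (norm_nonneg _).trans (hG xs hxs)
    positivity
  refine ⟨(|L + β| * D + G) * (‖x 1 - xs‖ / (1 - √q)), fun N => ?_⟩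
  calc ∑ n ∈ Finset.Icc 1 N, (f (x n) (x n) - sInf (f (x n) '' X))
      ≤ ∑ n ∈ Finset.Icc 1 N, (|L + β| * D + G) * ‖x n - xs‖ :=
        Finset.sum_le_sum fun n hn => hterm n (Finset.mem_Icc.1 hn).1
    _ = (|L + β| * D + G) * ∑ n ∈ Finset.Icc 1 N, ‖x n - xs‖ := (Finset.mul_sum ..).symm
    _ ≤ (|L + β| * D + G) * (‖x 1 - xs‖ / (1 - √q)) :=
        mul_le_mul_of_nonneg_left
          (sum_Icc_le_of_contraction hρ1 (fun n => norm_nonneg (x n - xs)) hcontr N) hK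
end
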